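/- arXiv:2202.13682 — 3 statements merged into one kernel-verified Lean document; each statement's English description precedes it below -/
import Mathlib

section
/- Let O be a nonsymmetric operad. Then the triple O^comp = ({O^comp(n)}_{n≥1}, ∘ᵢ^comp, 1) is a nonsymmetric operad; that is, the partial compositions ∘ᵢ^comp satisfy (f ∘ᵢ^comp g) ∘_{i+j−1}^comp h = f ∘ᵢ^comp (g ∘ⱼ^comp h) for 1 ≤ i ≤ m, 1 ≤ j ≤ n, (f ∘ᵢ^comp g) ∘_{j+n−1}^comp h = (f ∘ⱼ^comp h) ∘ᵢ^comp g for 1 ≤ i < j ≤ m, and f ∘ᵢ^comp 1 = 1 ∘₁^comp f = f. -/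
universe u v

/-- A nonsymmetric operad in the category of `k`-modules: a collection of `k`-modules
`O n` for `n ≥ 1` (here defined for all `n : ℕ`, with only arities `≥ 1` relevant),
`k`-bilinear partial compositions `comp : O m → ℕ → O n → O (m + n - 1)` (the middle
argument is the 1-based position `i`, `1 ≤ i ≤ m`), and an identity element `one ∈ O 1`,
satisfying the usual sequential/parallel associativity and unit axioms. -/
structure NSOperad (k : Type u) [CommRing k] where
  O : ℕ → Type v
  [instAdd : ∀ n, AddCommGroup (O n)]
  [instMod : ∀ n, Module k (O n)]
  comp : ∀ {m n : ℕ}, O m → ℕ → O n → O (m + n - 1)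
  one : O 1
  comp_add_left : ∀ {m n : ℕ} (f f' : O m) (i : ℕ) (g : O n),
    comp (f + f') i g = comp f i g + comp f' i g
  comp_add_right : ∀ {m n : ℕ} (f : O m) (i : ℕ) (g g' : O n),
    comp f i (g + g') = comp f i g + comp f i g'
  comp_smul_left : ∀ {m n : ℕ} (c : k) (f : O m) (i : ℕ) (g : O n),
    comp (c • f) i g = c • comp f i g
  comp_smul_right : ∀ {m n : ℕ} (c : k) (f : O m) (i : ℕ) (g : O n),
    comp f i (c • g) = c • comp f i g
  assoc₁ : ∀ {m n p : ℕ} (f : O m) (g : O n) (h : O p) (i j : ℕ)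
    (hi1 : 1 ≤ i) (him : i ≤ m) (hj1 : 1 ≤ j) (hjn : j ≤ n) (hp : 1 ≤ p),
    comp (comp f i g) (i + j - 1) h =
      cast (congrArg O (by omega : m + (n + p - 1) - 1 = m + n - 1 + p - 1))
        (comp f i (comp g j h))
  assoc₂ : ∀ {m n p : ℕ} (f : O m) (g : O n) (h : O p) (i j : ℕ)
    (hi1 : 1 ≤ i) (hij : i < j) (hjm : j ≤ m) (hn : 1 ≤ n) (hp : 1 ≤ p),
    comp (comp f i g) (j + n - 1) h =
      cast (congrArg O (by omega : m + p - 1 + n - 1 = m + n - 1 + p - 1))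
        (comp (comp f j h) i g)
  comp_one : ∀ {m : ℕ} (f : O m) (i : ℕ), 1 ≤ i → i ≤ m → comp f i one = f
  one_comp : ∀ {m : ℕ} (f : O m), comp one 1 f = cast (congrArg O (by omega : m = 1 + m - 1)) f

attribute [instance] NSOperad.instAdd NSOperad.instMod

namespace NSOperad

variable {k : Type u} [CommRing k]

/-- A multiplication on a nonsymmetric operad: `π ∈ O(2)` with `π ∘₁ π = π ∘₂ π`. -/
def IsMult (𝒪 : NSOperad k) (π : 𝒪.O 2) : Prop :=
  𝒪.comp π 1 π = 𝒪.comp π 2 π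

/-- The Gerstenhaber (degree `-1` graded Lie) bracket
`⟦f, g⟧ = Σᵢ (−1)^{(n−1)(i−1)} f ∘ᵢ g − (−1)^{(m−1)(n−1)} Σᵢ (−1)^{(m−1)(i−1)} g ∘ᵢ f`. -/
def bracket (𝒪 : NSOperad k) {m n : ℕ} (f : 𝒪.O m) (g : 𝒪.O n) : 𝒪.O (m + n - 1) :=
  (∑ i ∈ Finset.Icc 1 m, ((-1 : ℤ) ^ ((n - 1) * (i - 1))) • 𝒪.comp f i g)
    - ((-1 : ℤ) ^ ((m - 1) * (n - 1))) •
        ∑ i ∈ Finset.Icc 1 n,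
          ((-1 : ℤ) ^ ((m - 1) * (i - 1))) •
            cast (congrArg 𝒪.O (by omega : n + m - 1 = m + n - 1)) (𝒪.comp g i f)

end NSOperad

namespace NSOperad

variable {k : Type u} [CommRing k]

/-- `O^comp(n) = O(n) ⊕ ⋯ ⊕ O(n)` (`n` copies); an element `f` is written
`(f₁, …, f_n)`, here as a function `Fin n → O n` (so `f_r = f ⟨r-1⟩` for `1 ≤ r ≤ n`). -/
abbrev OComp (𝒪 : NSOperad k) (n : ℕ) : Type v := Fin n → 𝒪.O n

/-- The partial compositions of `O^comp`: the `k`-th component of `f ∘ᵢ^comp g` is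
`Σ_{r+s=k+1} f_r ∘ᵢ g_s` (1-based components; `kk : Fin (m+n-1)` is the 0-based index
of the `k = kk+1`-st component, and `p.1, p.2` are the 0-based indices of `r = p.1+1`,
`s = p.2+1`). -/
def ccomp (𝒪 : NSOperad k) {m n : ℕ} (f : 𝒪.OComp m) (i : ℕ) (g : 𝒪.OComp n) :
    𝒪.OComp (m + n - 1) := fun kk =>
  ∑ p ∈ Finset.univ.filter
      (fun p : Fin m × Fin n => ((p.1 : ℕ) + 1) + ((p.2 : ℕ) + 1) = ((kk : ℕ) + 1) + 1),
    𝒪.comp (f p.1) i (g p.2)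

/-- The identity element of `O^comp`, namely `1 ∈ O(1) = O^comp(1)`. -/
def cone (𝒪 : NSOperad k) : 𝒪.OComp 1 := fun _ => 𝒪.one

/-- Transport along an equality of arities. -/
def ocast (𝒪 : NSOperad k) {a b : ℕ} (h : a = b) (f : 𝒪.OComp a) : 𝒪.OComp b := h ▸ f

end NSOperad

namespace NSOperad

variable {k : Type u} [CommRing k]

/-- Partial composition with a fixed right argument, as an additive map. -/
def compLeftHom (𝒪 : NSOperad k) {m n : ℕ} (i : ℕ) (g : 𝒪.O n) :
    𝒪.O m →+ 𝒪.O (m + n - 1) :=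
  AddMonoidHom.mk' (fun f => 𝒪.comp f i g) (fun f₁ f₂ => 𝒪.comp_add_left f₁ f₂ i g)

/-- Partial composition with a fixed left argument, as an additive map. -/
def compRightHom (𝒪 : NSOperad k) {m n : ℕ} (f : 𝒪.O m) (i : ℕ) :
    𝒪.O n →+ 𝒪.O (m + n - 1) :=
  AddMonoidHom.mk' (fun g => 𝒪.comp f i g) (fun g₁ g₂ => 𝒪.comp_add_right f i g₁ g₂)

/-- Transport along an equality of arities, as an additive map. -/
def castHom (𝒪 : NSOperad k) {a b : ℕ} (h : a = b) : 𝒪.O a →+ 𝒪.O b :=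
  AddMonoidHom.mk' (cast (congrArg 𝒪.O h)) (by subst h; intros; rfl)

theorem castHom_apply (𝒪 : NSOperad k) {a b : ℕ} (h : a = b) (x : 𝒪.O a) :
    𝒪.castHom h x = cast (congrArg 𝒪.O h) x := rfl

theorem ocast_apply (𝒪 : NSOperad k) {a b : ℕ} (h : a = b) (f : 𝒪.OComp a) (x : Fin b) :
    𝒪.ocast h f x = 𝒪.castHom h (f (Fin.cast h.symm x)) := by
  subst h; rfl

theorem ccomp_apply (𝒪 : NSOperad k) {m n : ℕ} (f : 𝒪.OComp m) (i : ℕ) (g : 𝒪.OComp n)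
    (x : Fin (m + n - 1)) :
    𝒪.ccomp f i g x =
      ∑ a : Fin m, ∑ b : Fin n,
        if (a : ℕ) + (b : ℕ) = (x : ℕ) then 𝒪.comp (f a) i (g b) else 0 := by
  rw [ccomp, Finset.sum_filter, Fintype.sum_prod_type]
  refine Finset.sum_congr rfl fun a _ => Finset.sum_congr rfl fun b _ => ?_
  exact if_congr (by dsimp only; omega) rfl rfl

theorem map_ccomp_apply (𝒪 : NSOperad k) {m n : ℕ} {M : Type*} [AddCommMonoid M]
    (f : 𝒪.OComp m) (i : ℕ) (g : 𝒪.OComp n) (φ : 𝒪.O (m + n - 1) →+ M)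
    (x : Fin (m + n - 1)) :
    φ (𝒪.ccomp f i g x) =
      ∑ a : Fin m, ∑ b : Fin n,
        if (a : ℕ) + (b : ℕ) = (x : ℕ) then φ (𝒪.comp (f a) i (g b)) else 0 := by
  simp only [ccomp_apply, map_sum, apply_ite φ, map_zero]

/-- Summing an additive function of the components of `f ∘ᵢ^comp g`, restricted by a
condition on the component index, amounts to summing over pairs of components. -/
theorem sum_map_ccomp (𝒪 : NSOperad k) {m n : ℕ} {M : Type*} [AddCommMonoid M]
    (f : 𝒪.OComp m) (i : ℕ) (g : 𝒪.OComp n) (φ : 𝒪.O (m + n - 1) →+ M)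
    (P : ℕ → Prop) [DecidablePred P] :
    (∑ x : Fin (m + n - 1), if P (x : ℕ) then φ (𝒪.ccomp f i g x) else 0) =
      ∑ a : Fin m, ∑ b : Fin n,
        if P ((a : ℕ) + (b : ℕ)) then φ (𝒪.comp (f a) i (g b)) else 0 := by
  have expand (x : Fin (m + n - 1)) : (if P (x : ℕ) then φ (𝒪.ccomp f i g x) else 0) =
      ∑ a : Fin m, ∑ b : Fin n, if (a : ℕ) + (b : ℕ) = (x : ℕ) then
        (if P ((a : ℕ) + (b : ℕ)) then φ (𝒪.comp (f a) i (g b)) else 0) else 0 := by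
    rw [map_ccomp_apply]
    split_ifs with hP
    · refine Finset.sum_congr rfl fun a _ => Finset.sum_congr rfl fun b _ => ?_
      split_ifs <;> simp_all
    · refine (Finset.sum_eq_zero fun a _ => Finset.sum_eq_zero fun b _ => ?_).symm
      split_ifs <;> simp_all
  rw [Finset.sum_congr rfl fun x _ => expand x, Finset.sum_comm]
  refine Finset.sum_congr rfl fun a _ => ?_
  rw [Finset.sum_comm]
  refine Finset.sum_congr rfl fun b _ => ?_
  rw [Finset.sum_eq_single (⟨(a : ℕ) + b, by omega⟩ : Fin (m + n - 1))]
  · exact if_pos rfl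
  · exact fun y _ hy => if_neg fun h => hy (Fin.ext h.symm)
  · exact fun h => absurd (Finset.mem_univ _) h

theorem ccomp_ccomp_left_apply (𝒪 : NSOperad k) {m n p : ℕ} (f : 𝒪.OComp m) (i : ℕ)
    (g : 𝒪.OComp n) (l : ℕ) (h : 𝒪.OComp p) (x : Fin (m + n - 1 + p - 1)) :
    𝒪.ccomp (𝒪.ccomp f i g) l h x =
      ∑ a : Fin m, ∑ b : Fin n, ∑ c : Fin p, if (a : ℕ) + b + c = (x : ℕ) then
        𝒪.comp (𝒪.comp (f a) i (g b)) l (h c) else 0 := by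
  rw [ccomp_apply, Finset.sum_comm]
  have key (c : Fin p) := 𝒪.sum_map_ccomp f i g (𝒪.compLeftHom l (h c))
    (fun y => y + (c : ℕ) = x)
  refine (Finset.sum_congr rfl fun c _ => key c).trans ?_
  rw [Finset.sum_comm]
  exact Finset.sum_congr rfl fun a _ => Finset.sum_comm

theorem ccomp_ccomp_right_apply (𝒪 : NSOperad k) {m n p : ℕ} (f : 𝒪.OComp m) (i : ℕ)
    (g : 𝒪.OComp n) (j : ℕ) (h : 𝒪.OComp p) (x : Fin (m + (n + p - 1) - 1)) :
    𝒪.ccomp f i (𝒪.ccomp g j h) x =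
      ∑ a : Fin m, ∑ b : Fin n, ∑ c : Fin p, if (a : ℕ) + b + c = (x : ℕ) then
        𝒪.comp (f a) i (𝒪.comp (g b) j (h c)) else 0 := by
  simp only [add_assoc]
  rw [ccomp_apply]
  exact Finset.sum_congr rfl fun a _ =>
    𝒪.sum_map_ccomp g j h (𝒪.compRightHom (f a) i) (fun y => (a : ℕ) + y = x)

end NSOperad

/-- For any nonsymmetric operad `𝒪`, the triple
`𝒪^comp = ({O^comp(n)}, ∘ᵢ^comp, 1)` is again a nonsymmetric operad: the partial
compositions `∘ᵢ^comp` satisfy the two associativity axioms and the unit axioms. -/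
theorem NSOperad.comp_construction_isOperad
    {k : Type u} [CommRing k] [CharZero k] (𝒪 : NSOperad k) :
    (∀ {m n p : ℕ} (f : 𝒪.OComp m) (g : 𝒪.OComp n) (h : 𝒪.OComp p) (i j : ℕ)
        (hi1 : 1 ≤ i) (him : i ≤ m) (hj1 : 1 ≤ j) (hjn : j ≤ n) (hp : 1 ≤ p),
      𝒪.ccomp (𝒪.ccomp f i g) (i + j - 1) h =
        𝒪.ocast (by omega : m + (n + p - 1) - 1 = m + n - 1 + p - 1)
          (𝒪.ccomp f i (𝒪.ccomp g j h))) ∧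
    (∀ {m n p : ℕ} (f : 𝒪.OComp m) (g : 𝒪.OComp n) (h : 𝒪.OComp p) (i j : ℕ)
        (hi1 : 1 ≤ i) (hij : i < j) (hjm : j ≤ m) (hn : 1 ≤ n) (hp : 1 ≤ p),
      𝒪.ccomp (𝒪.ccomp f i g) (j + n - 1) h =
        𝒪.ocast (by omega : m + p - 1 + n - 1 = m + n - 1 + p - 1)
          (𝒪.ccomp (𝒪.ccomp f j h) i g)) ∧
    (∀ {m : ℕ} (f : 𝒪.OComp m) (i : ℕ), 1 ≤ i → i ≤ m → 𝒪.ccomp f i 𝒪.cone = f) ∧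
    (∀ {m : ℕ} (f : 𝒪.OComp m),
      𝒪.ccomp 𝒪.cone 1 f = 𝒪.ocast (by omega : m = 1 + m - 1) f) := by
  refine ⟨fun {m n p} f g h i j hi1 him hj1 hjn hp => ?_,
    fun {m n p} f g h i j hi1 hij hjm hn hp => ?_, fun {m} f i hi him => ?_,
    fun {m} f => ?_⟩
  · funext x
    rw [ocast_apply, ccomp_ccomp_left_apply, ccomp_ccomp_right_apply]
    simp only [map_sum, apply_ite (𝒪.castHom _), map_zero, castHom_apply, Fin.val_cast,
      𝒪.assoc₁ _ _ _ i j hi1 him hj1 hjn hp]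
  · funext x
    rw [ocast_apply, ccomp_ccomp_left_apply, ccomp_ccomp_left_apply]
    simp only [map_sum, apply_ite (𝒪.castHom _), map_zero, castHom_apply, Fin.val_cast,
      𝒪.assoc₂ _ _ _ i j hi1 hij hjm hn hp]
    refine Finset.sum_congr rfl fun a _ => ?_
    rw [Finset.sum_comm]
    exact Finset.sum_congr rfl fun c _ => Finset.sum_congr rfl fun b _ =>
      if_congr (by rw [add_right_comm]) rfl rfl
  · funext x
    simp [ccomp_apply, cone, 𝒪.comp_one _ i hi him, ← Fin.ext_iff]
  · funext x
    rw [ocast_apply, ccomp_apply, castHom_apply]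
    have index_eq (b : Fin m) : (b : ℕ) = (x : ℕ) ↔ b = Fin.cast (by omega) x := by
      simp [Fin.ext_iff]
    simp [cone, 𝒪.one_comp, index_eq]
end

section
/- Let O be a nonsymmetric operad. Then the triple O^Dend = ({O^Dend(n)}_{n≥1}, ∘ᵢ^Dend, 1) is a nonsymmetric operad; that is, the partial compositions ∘ᵢ^Dend satisfy (f ∘ᵢ^Dend g) ∘_{i+j−1}^Dend h = f ∘ᵢ^Dend (g ∘ⱼ^Dend h) for 1 ≤ i ≤ m, 1 ≤ j ≤ n, (f ∘ᵢ^Dend g) ∘_{j+n−1}^Dend h = (f ∘ⱼ^Dend h) ∘ᵢ^Dend g for 1 ≤ i < j ≤ m, and f ∘ᵢ^Dend 1 = 1 ∘₁^Dend f = f. -/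
universe u v

namespace NSOperad

variable {k : Type u} [CommRing k]

/-- A dendriform-multiplication on a nonsymmetric operad: a pair `(π_≺, π_≻)` of
elements of `O(2)` satisfying the three dendriform identities. -/
def IsDendMult (𝒪 : NSOperad k) (πl πr : 𝒪.O 2) : Prop :=
  𝒪.comp πl 1 πl = 𝒪.comp πl 2 (πl + πr) ∧
  𝒪.comp πl 1 πr = 𝒪.comp πr 2 πl ∧
  𝒪.comp πr 1 (πl + πr) = 𝒪.comp πr 2 πr

end NSOperad

namespace NSOperad

variable {k : Type u} [CommRing k]

/-- `O^Dend(n) = O(n) ⊕ ⋯ ⊕ O(n)` (`n` copies); an element `f` is written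
`(f^[1], …, f^[n])`, here as a function `Fin n → O n`. -/
abbrev ODend (𝒪 : NSOperad k) (n : ℕ) : Type v := Fin n → 𝒪.O n

/-- The (1-based) `r`-th component `f^[r]` of `f ∈ O^Dend(n)` (zero if `r` is out of
range). -/
def dnth (𝒪 : NSOperad k) {n : ℕ} (f : 𝒪.ODend n) (r : ℕ) : 𝒪.O n :=
  if h : 1 ≤ r ∧ r ≤ n then f ⟨r - 1, by omega⟩ else 0

/-- The partial compositions of `O^Dend` (components 1-based, `r = kk + 1`):
`(f ∘ᵢ^Dend g)^[r] = f^[r] ∘ᵢ (g^[1] + ⋯ + g^[n])` if `r ≤ i−1`;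
`(f ∘ᵢ^Dend g)^[r] = f^[i] ∘ᵢ g^[r−i+1]` if `i ≤ r ≤ i+n−1`;
`(f ∘ᵢ^Dend g)^[r] = f^[r−n+1] ∘ᵢ (g^[1] + ⋯ + g^[n])` if `i+n ≤ r ≤ m+n−1`. -/
def dcomp (𝒪 : NSOperad k) {m n : ℕ} (f : 𝒪.ODend m) (i : ℕ) (g : 𝒪.ODend n) :
    𝒪.ODend (m + n - 1) := fun kk =>
  let r := (kk : ℕ) + 1
  if r ≤ i - 1 then 𝒪.comp (𝒪.dnth f r) i (∑ s ∈ Finset.Icc 1 n, 𝒪.dnth g s)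
  else if r ≤ i + n - 1 then 𝒪.comp (𝒪.dnth f i) i (𝒪.dnth g (r - i + 1))
  else 𝒪.comp (𝒪.dnth f (r - n + 1)) i (∑ s ∈ Finset.Icc 1 n, 𝒪.dnth g s)

/-- The identity element of `O^Dend`, namely `1 ∈ O(1) = O^Dend(1)`. -/
def done (𝒪 : NSOperad k) : 𝒪.ODend 1 := fun _ => 𝒪.one

/-- Transport along an equality of arities. -/
def dcast (𝒪 : NSOperad k) {a b : ℕ} (h : a = b) (f : 𝒪.ODend a) : 𝒪.ODend b := h ▸ f

end NSOperad

namespace NSOperad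

variable {k : Type u} [CommRing k] (𝒪 : NSOperad k)

theorem comp_zero_left {m n : ℕ} (i : ℕ) (g : 𝒪.O n) : 𝒪.comp (0 : 𝒪.O m) i g = 0 := by
  simpa using 𝒪.comp_smul_left (0 : k) (0 : 𝒪.O m) i g

theorem comp_zero_right {m n : ℕ} (f : 𝒪.O m) (i : ℕ) : 𝒪.comp f i (0 : 𝒪.O n) = 0 := by
  simpa using 𝒪.comp_smul_right (0 : k) f i (0 : 𝒪.O n)

theorem sum_comp {ι : Type*} {m n : ℕ} (s : Finset ι) (F : ι → 𝒪.O m) (i : ℕ) (g : 𝒪.O n) :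
    𝒪.comp (∑ x ∈ s, F x) i g = ∑ x ∈ s, 𝒪.comp (F x) i g :=
  map_sum (⟨⟨fun f => 𝒪.comp f i g, 𝒪.comp_zero_left i g⟩,
    fun f f' => 𝒪.comp_add_left f f' i g⟩ : 𝒪.O m →+ 𝒪.O (m + n - 1)) F s

theorem comp_sum {ι : Type*} {m n : ℕ} (s : Finset ι) (f : 𝒪.O m) (i : ℕ) (G : ι → 𝒪.O n) :
    𝒪.comp f i (∑ x ∈ s, G x) = ∑ x ∈ s, 𝒪.comp f i (G x) :=
  map_sum (⟨⟨fun g => 𝒪.comp f i g, 𝒪.comp_zero_right f i⟩,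
    fun g g' => 𝒪.comp_add_right f i g g'⟩ : 𝒪.O n →+ 𝒪.O (m + n - 1)) G s

theorem dnth_of_not_mem {n : ℕ} (f : 𝒪.ODend n) {r : ℕ} (hr : ¬(1 ≤ r ∧ r ≤ n)) :
    𝒪.dnth f r = 0 :=
  dif_neg hr

variable {𝒪} in
theorem ODend_ext {n : ℕ} {f g : 𝒪.ODend n}
    (h : ∀ r, 1 ≤ r → r ≤ n → 𝒪.dnth f r = 𝒪.dnth g r) : f = g := by
  funext x
  have hx : 1 ≤ (x : ℕ) + 1 ∧ (x : ℕ) + 1 ≤ n := by omega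
  simpa [dnth, hx] using h (x + 1) hx.1 hx.2

theorem dnth_dcast {a b : ℕ} (h : a = b) (f : 𝒪.ODend a) (r : ℕ) :
    𝒪.dnth (𝒪.dcast h f) r = cast (congrArg 𝒪.O h) (𝒪.dnth f r) := by
  subst h
  rfl

theorem dnth_done : 𝒪.dnth 𝒪.done 1 = 𝒪.one := by
  simp [dnth, done]

/-- The componentwise formula for `∘ᵢ^Dend` holds at every index, both sides being zero out of
range. -/
theorem dnth_dcomp {m n : ℕ} (f : 𝒪.ODend m) (i : ℕ) (g : 𝒪.ODend n) (hi : 1 ≤ i) (him : i ≤ m)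
    (r : ℕ) :
    𝒪.dnth (𝒪.dcomp f i g) r =
      if r < i then 𝒪.comp (𝒪.dnth f r) i (∑ s ∈ Finset.Icc 1 n, 𝒪.dnth g s)
      else if r < i + n then 𝒪.comp (𝒪.dnth f i) i (𝒪.dnth g (r - i + 1))
      else 𝒪.comp (𝒪.dnth f (r - n + 1)) i (∑ s ∈ Finset.Icc 1 n, 𝒪.dnth g s) := by
  by_cases hr : 1 ≤ r ∧ r ≤ m + n - 1
  · have h1 : r ≤ i - 1 ↔ r < i := by omega
    have h2 : r ≤ i + n - 1 ↔ r < i + n := by omega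
    rw [dnth, dif_pos hr]
    simp only [dcomp, Nat.sub_add_cancel hr.1, h1, h2]
  · rw [dnth_of_not_mem _ _ hr]
    split_ifs
    · rw [dnth_of_not_mem _ f (by omega), comp_zero_left]
    · omega
    · rw [dnth_of_not_mem _ f (by omega), comp_zero_left]

theorem sum_dnth_dcomp {m n : ℕ} (f : 𝒪.ODend m) (i : ℕ) (g : 𝒪.ODend n) (hi : 1 ≤ i)
    (him : i ≤ m) :
    ∑ r ∈ Finset.Icc 1 (m + n - 1), 𝒪.dnth (𝒪.dcomp f i g) r =
      𝒪.comp (∑ r ∈ Finset.Icc 1 m, 𝒪.dnth f r) i (∑ s ∈ Finset.Icc 1 n, 𝒪.dnth g s) := by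
  have hIcc : Finset.Icc 1 (m + n - 1) = Finset.Ico 1 (m + n) := by
    ext; simp only [Finset.mem_Icc, Finset.mem_Ico]; omega
  have hm : Finset.Icc 1 m = Finset.Ico 1 (m + 1) := by
    ext; simp only [Finset.mem_Icc, Finset.mem_Ico]; omega
  have hn : Finset.Icc 1 n = Finset.Ico 1 (n + 1) := by
    ext; simp only [Finset.mem_Icc, Finset.mem_Ico]; omega
  set G := ∑ s ∈ Finset.Icc 1 n, 𝒪.dnth g s with hG
  have low : ∑ r ∈ Finset.Ico 1 i, 𝒪.dnth (𝒪.dcomp f i g) r =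
      ∑ r ∈ Finset.Ico 1 i, 𝒪.comp (𝒪.dnth f r) i G := by
    refine Finset.sum_congr rfl fun r hr => ?_
    rw [𝒪.dnth_dcomp f i g hi him, if_pos (Finset.mem_Ico.1 hr).2]
  have mid : ∑ r ∈ Finset.Ico i (i + n), 𝒪.dnth (𝒪.dcomp f i g) r =
      𝒪.comp (𝒪.dnth f i) i G := by
    rw [hG, comp_sum, hn, Finset.sum_Ico_eq_sum_range, Finset.sum_Ico_eq_sum_range]
    refine Finset.sum_congr (by simp) fun r hr => ?_
    rw [Finset.mem_range] at hr
    rw [𝒪.dnth_dcomp f i g hi him, if_neg (by omega), if_pos (by omega),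
      show i + r - i + 1 = 1 + r by omega]
  have high : ∑ r ∈ Finset.Ico (i + n) (m + n), 𝒪.dnth (𝒪.dcomp f i g) r =
      ∑ r ∈ Finset.Ico (i + 1) (m + 1), 𝒪.comp (𝒪.dnth f r) i G := by
    rw [Finset.sum_Ico_eq_sum_range, Finset.sum_Ico_eq_sum_range]
    refine Finset.sum_congr (by congr 1; omega) fun r _ => ?_
    rw [𝒪.dnth_dcomp f i g hi him, if_neg (by omega), if_neg (by omega),
      show i + n + r - n + 1 = i + 1 + r by omega]
  rw [hIcc, ← Finset.sum_Ico_consecutive _ hi (by omega : i ≤ m + n),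
    ← Finset.sum_Ico_consecutive _ (by omega : i ≤ i + n) (by omega : i + n ≤ m + n),
    low, mid, high, hm, sum_comp, ← Finset.sum_Ico_consecutive _ hi (by omega : i ≤ m + 1),
    Finset.sum_eq_sum_Ico_succ_bot (by omega : i < m + 1)]

theorem dcomp_assoc₁ {m n p : ℕ} (f : 𝒪.ODend m) (g : 𝒪.ODend n) (h : 𝒪.ODend p) (i j : ℕ)
    (hi1 : 1 ≤ i) (him : i ≤ m) (hj1 : 1 ≤ j) (hjn : j ≤ n) (hp : 1 ≤ p) :
    𝒪.dcomp (𝒪.dcomp f i g) (i + j - 1) h =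
      𝒪.dcast (by omega : m + (n + p - 1) - 1 = m + n - 1 + p - 1)
        (𝒪.dcomp f i (𝒪.dcomp g j h)) := by
  refine ODend_ext fun r _ _ => ?_
  rw [dnth_dcast, dnth_dcomp _ _ _ _ (by omega) (by omega), 𝒪.dnth_dcomp f i (𝒪.dcomp g j h) hi1 him,
    sum_dnth_dcomp _ _ _ _ hj1 hjn]
  simp only [𝒪.dnth_dcomp f i g hi1 him, 𝒪.dnth_dcomp g j h hj1 hjn]
  split_ifs <;> first
    | omega
    | rw [𝒪.assoc₁ _ _ _ i j hi1 him hj1 hjn hp] <;> congr! 4 <;> omega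

theorem dcomp_assoc₂ {m n p : ℕ} (f : 𝒪.ODend m) (g : 𝒪.ODend n) (h : 𝒪.ODend p) (i j : ℕ)
    (hi1 : 1 ≤ i) (hij : i < j) (hjm : j ≤ m) (hn : 1 ≤ n) (hp : 1 ≤ p) :
    𝒪.dcomp (𝒪.dcomp f i g) (j + n - 1) h =
      𝒪.dcast (by omega : m + p - 1 + n - 1 = m + n - 1 + p - 1)
        (𝒪.dcomp (𝒪.dcomp f j h) i g) := by
  have him : i ≤ m := by omega
  have hj1 : 1 ≤ j := by omega
  refine ODend_ext fun r _ _ => ?_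
  rw [dnth_dcast, dnth_dcomp _ _ _ _ (by omega) (by omega),
    𝒪.dnth_dcomp (𝒪.dcomp f j h) i g hi1 (by omega)]
  simp only [𝒪.dnth_dcomp f i g hi1 him, 𝒪.dnth_dcomp f j h hj1 hjm]
  split_ifs <;> first
    | omega
    | rw [𝒪.assoc₂ _ _ _ i j hi1 hij hjm hn hp] <;> congr! 4 <;> omega

theorem dcomp_done {m : ℕ} (f : 𝒪.ODend m) (i : ℕ) (hi : 1 ≤ i) (him : i ≤ m) :
    𝒪.dcomp f i 𝒪.done = f := by
  refine ODend_ext (n := m) fun r hr _ => ?_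
  have key := 𝒪.dnth_dcomp f i 𝒪.done hi him r
  rw [Finset.Icc_self, Finset.sum_singleton, dnth_done] at key
  refine key.trans ?_
  split_ifs
  · exact 𝒪.comp_one _ i hi him
  · obtain rfl : r = i := by omega
    rw [Nat.sub_self, Nat.zero_add, dnth_done]
    exact 𝒪.comp_one _ r hi him
  · rw [Nat.sub_add_cancel hr]
    exact 𝒪.comp_one _ i hi him

theorem done_dcomp {m : ℕ} (f : 𝒪.ODend m) :
    𝒪.dcomp 𝒪.done 1 f = 𝒪.dcast (by omega : m = 1 + m - 1) f := by
  refine ODend_ext fun r hr hrm => ?_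
  rw [dnth_dcast, dnth_dcomp _ _ _ _ le_rfl le_rfl, if_neg (by omega), if_pos (by omega),
    dnth_done, 𝒪.one_comp, Nat.sub_add_cancel hr]

end NSOperad

/-- For any nonsymmetric operad `𝒪`, the triple
`𝒪^Dend = ({O^Dend(n)}, ∘ᵢ^Dend, 1)` is again a nonsymmetric operad: the partial
compositions `∘ᵢ^Dend` satisfy the two associativity axioms and the unit axioms. -/
theorem NSOperad.dend_construction_isOperad
    {k : Type u} [CommRing k] [CharZero k] (𝒪 : NSOperad k) :
    (∀ {m n p : ℕ} (f : 𝒪.ODend m) (g : 𝒪.ODend n) (h : 𝒪.ODend p) (i j : ℕ)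
        (hi1 : 1 ≤ i) (him : i ≤ m) (hj1 : 1 ≤ j) (hjn : j ≤ n) (hp : 1 ≤ p),
      𝒪.dcomp (𝒪.dcomp f i g) (i + j - 1) h =
        𝒪.dcast (by omega : m + (n + p - 1) - 1 = m + n - 1 + p - 1)
          (𝒪.dcomp f i (𝒪.dcomp g j h))) ∧
    (∀ {m n p : ℕ} (f : 𝒪.ODend m) (g : 𝒪.ODend n) (h : 𝒪.ODend p) (i j : ℕ)
        (hi1 : 1 ≤ i) (hij : i < j) (hjm : j ≤ m) (hn : 1 ≤ n) (hp : 1 ≤ p),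
      𝒪.dcomp (𝒪.dcomp f i g) (j + n - 1) h =
        𝒪.dcast (by omega : m + p - 1 + n - 1 = m + n - 1 + p - 1)
          (𝒪.dcomp (𝒪.dcomp f j h) i g)) ∧
    (∀ {m : ℕ} (f : 𝒪.ODend m) (i : ℕ), 1 ≤ i → i ≤ m → 𝒪.dcomp f i 𝒪.done = f) ∧
    (∀ {m : ℕ} (f : 𝒪.ODend m),
      𝒪.dcomp 𝒪.done 1 f = 𝒪.dcast (by omega : m = 1 + m - 1) f) :=
  ⟨𝒪.dcomp_assoc₁, 𝒪.dcomp_assoc₂, 𝒪.dcomp_done, 𝒪.done_dcomp⟩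
end

section
/- Let Ω be a semigroup and O a nonsymmetric operad. Then the triple O^Ω = ({O^Ω(n)}_{n≥1}, ∘ᵢ^Ω, 1) is a nonsymmetric operad; that is, the partial compositions ∘ᵢ^Ω satisfy (f ∘ᵢ^Ω g) ∘_{i+j−1}^Ω h = f ∘ᵢ^Ω (g ∘ⱼ^Ω h) for 1 ≤ i ≤ m, 1 ≤ j ≤ n, (f ∘ᵢ^Ω g) ∘_{j+n−1}^Ω h = (f ∘ⱼ^Ω h) ∘ᵢ^Ω g for 1 ≤ i < j ≤ m, and f ∘ᵢ^Ω 1 = 1 ∘₁^Ω f = f. -/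
universe u v

universe w

namespace NSOperad

variable {k : Type u} [CommRing k]

/-- `O^Ω(n)`: families `{f_{α₁,…,α_n} ∈ O(n)}` of elements of `O(n)` labelled by
`Ω^{×n}` (here `α : Fin n → Ω` is the 0-based tuple of labels). -/
def OFam (𝒪 : NSOperad k) (Ω : Type w) (n : ℕ) : Type _ := (Fin n → Ω) → 𝒪.O n

/-- The ordered semigroup product `α a * α (a+1) * ⋯ * α (a+l)` of `l+1` factors. -/
def sprod {Ω : Type w} [Semigroup Ω] (α : ℕ → Ω) (a : ℕ) : ℕ → Ω
  | 0 => α a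
  | l + 1 => sprod α a l * α (a + l + 1)

/-- The partial compositions of `O^Ω`:
`(f ∘ᵢ^Ω g)_{α₁,…,α_{m+n−1}} = f_{α₁,…,α_{i−1}, αᵢ⋯α_{i+n−1}, α_{i+n},…,α_{m+n−1}} ∘ᵢ g_{αᵢ,…,α_{i+n−1}}`.
(The labels are handled 0-based via the auxiliary function `β`, which agrees with `α`
on all relevant indices; the hypotheses `1 ≤ n`, `1 ≤ i ≤ m` make the index
bookkeeping total.) -/
def ωcomp (𝒪 : NSOperad k) {Ω : Type w} [Semigroup Ω] {m n : ℕ} (hn : 1 ≤ n)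
    (f : 𝒪.OFam Ω m) (i : ℕ) (hi1 : 1 ≤ i) (him : i ≤ m) (g : 𝒪.OFam Ω n) :
    𝒪.OFam Ω (m + n - 1) := fun α =>
  let β : ℕ → Ω := fun s => α ⟨min s (m + n - 2), by omega⟩
  𝒪.comp
    (f (fun t => if (t : ℕ) < i - 1 then β t
                 else if (t : ℕ) = i - 1 then sprod β (i - 1) (n - 1)
                 else β ((t : ℕ) + n - 1)))
    i
    (g (fun s => β (i - 1 + (s : ℕ))))

/-- The identity element of `O^Ω(1)`: the constant family with value `1 ∈ O(1)`. -/
def ωone (𝒪 : NSOperad k) (Ω : Type w) : 𝒪.OFam Ω 1 := fun _ => 𝒪.one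

/-- Transport along an equality of arities. -/
def ωcast (𝒪 : NSOperad k) {Ω : Type w} {a b : ℕ} (h : a = b) (f : 𝒪.OFam Ω a) :
    𝒪.OFam Ω b := h ▸ f

end NSOperad

namespace NSOperad

section Collapse

variable {Ω : Type w} [Semigroup Ω]

theorem sprod_congr {A B : ℕ → Ω} {a q : ℕ} (h : ∀ s, a ≤ s → s ≤ a + q → A s = B s) :
    sprod A a q = sprod B a q := by
  induction q with
  | zero => exact h a le_rfl le_rfl
  | succ q ih =>
    simp only [sprod]
    rw [ih fun s h₁ h₂ => h s h₁ (by omega), h _ (by omega) (by omega)]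

theorem sprod_shift (A : ℕ → Ω) (a b q : ℕ) :
    sprod (fun s => A (a + s)) b q = sprod A (a + b) q := by
  induction q with
  | zero => rfl
  | succ q ih => simp only [sprod, ih, add_assoc]

theorem sprod_mul_sprod (A : ℕ → Ω) (a x y : ℕ) :
    sprod A a x * sprod A (a + x + 1) y = sprod A a (x + y + 1) := by
  induction y with
  | zero => rfl
  | succ y ih =>
    rw [← add_assoc x y 1]
    simp only [sprod] at ih ⊢
    rw [← mul_assoc, ih]
    congr 2
    omega

/-- The sequence obtained from `A` by replacing the entries `A a, …, A (a + l)` by their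
product. -/
def collapse (A : ℕ → Ω) (a l t : ℕ) : Ω :=
  if t < a then A t else if t = a then sprod A a l else A (t + l)

theorem collapse_of_lt (A : ℕ → Ω) {a t : ℕ} (l : ℕ) (h : t < a) : collapse A a l t = A t :=
  if_pos h

theorem collapse_self (A : ℕ → Ω) (a l : ℕ) : collapse A a l a = sprod A a l := by
  simp [collapse]

theorem collapse_of_gt (A : ℕ → Ω) {a t : ℕ} (l : ℕ) (h : a < t) :
    collapse A a l t = A (t + l) := by
  simp [collapse, h.not_gt, h.ne']

theorem collapse_zero (A : ℕ → Ω) (a : ℕ) : collapse A a 0 = A := by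
  funext t
  rcases lt_trichotomy t a with h | rfl | h
  · exact collapse_of_lt A 0 h
  · exact collapse_self A t 0
  · exact collapse_of_gt A 0 h

theorem collapse_shift (A : ℕ → Ω) (a b l t : ℕ) :
    collapse (fun s => A (a + s)) b l t = collapse A (a + b) l (a + t) := by
  simp only [collapse, sprod_shift, add_assoc, add_lt_add_iff_left, add_right_inj]

theorem sprod_collapse_of_lt (A : ℕ → Ω) {a c q : ℕ} (l : ℕ) (h : a + q < c) :
    sprod (collapse A c l) a q = sprod A a q :=
  sprod_congr fun _ _ _ => collapse_of_lt A l (by omega)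

theorem sprod_collapse_of_gt (A : ℕ → Ω) {a c : ℕ} (l q : ℕ) (h : c < a) :
    sprod (collapse A c l) a q = sprod A (a + l) q := by
  rw [add_comm a l, ← sprod_shift]
  exact sprod_congr fun s _ _ => by rw [collapse_of_gt A l (by omega), add_comm]

theorem sprod_collapse_of_mem (A : ℕ → Ω) {a b q : ℕ} (l : ℕ) (h : b ≤ q) :
    sprod (collapse A (a + b) l) a q = sprod A a (q + l) := by
  induction q with
  | zero =>
    obtain rfl : b = 0 := by omega
    simp [sprod, collapse_self]
  | succ q ih =>
    rw [sprod]
    rcases h.lt_or_eq with h | rfl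
    · rw [ih (by omega), collapse_of_gt A l (by omega), show q + 1 + l = q + l + 1 by omega, sprod]
      congr 2
      omega
    · rw [sprod_collapse_of_lt A l (by omega), ← add_assoc, collapse_self, sprod_mul_sprod]
      congr 1
      omega

theorem collapse_collapse_of_mem (A : ℕ → Ω) {a b q : ℕ} (l : ℕ) (h : b ≤ q) :
    collapse (collapse A (a + b) l) a q = collapse A a (q + l) := by
  funext t
  rcases lt_trichotomy t a with ht | rfl | ht
  · rw [collapse_of_lt _ _ ht, collapse_of_lt _ _ ht, collapse_of_lt _ _ (by omega)]
  · rw [collapse_self, collapse_self, sprod_collapse_of_mem A l h]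
  · rw [collapse_of_gt _ _ ht, collapse_of_gt _ _ ht, collapse_of_gt _ _ (by omega), add_assoc]

theorem collapse_collapse_comm (A : ℕ → Ω) {a c : ℕ} (q l : ℕ) (h : a < c) :
    collapse (collapse A (c + q) l) a q = collapse (collapse A a q) c l := by
  funext t
  rcases lt_trichotomy t a with ht | rfl | ht
  · rw [collapse_of_lt _ _ ht, collapse_of_lt _ _ (by omega), collapse_of_lt _ _ (by omega),
      collapse_of_lt _ _ ht]
  · rw [collapse_self, collapse_of_lt _ _ h, collapse_self, sprod_collapse_of_lt A l (by omega)]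
  · rw [collapse_of_gt _ _ ht]
    rcases lt_trichotomy t c with hc | rfl | hc
    · rw [collapse_of_lt _ _ (by omega), collapse_of_lt _ _ hc, collapse_of_gt _ _ ht]
    · rw [collapse_self, collapse_self, sprod_collapse_of_gt A q l h]
    · rw [collapse_of_gt _ _ (by omega), collapse_of_gt _ _ hc, collapse_of_gt _ _ (by omega)]
      congr 1
      omega

end Collapse

variable {k : Type u} [CommRing k] (𝒪 : NSOperad k) {Ω : Type w}

theorem ωcast_apply {a b : ℕ} (h : a = b) (f : 𝒪.OFam Ω a) (A : ℕ → Ω) :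
    𝒪.ωcast h f (fun t => A t) = cast (congrArg 𝒪.O h) (f fun t => A t) := by
  subst h
  rfl

theorem OFam.ext_of_nat {n : ℕ} (hn : 1 ≤ n) {f g : 𝒪.OFam Ω n}
    (h : ∀ A : ℕ → Ω, f (fun t => A t) = g fun t => A t) : f = g := by
  funext α
  have hα : (fun t : Fin n => α ⟨min t (n - 1), by omega⟩) = α :=
    funext fun t => congrArg α (Fin.ext (min_eq_left (by omega)))
  rw [← hα]
  exact h fun s => α ⟨min s (n - 1), by omega⟩

variable [Semigroup Ω]

theorem ωcomp_apply {m n : ℕ} (hn : 1 ≤ n) (f : 𝒪.OFam Ω m) (i : ℕ) (hi1 : 1 ≤ i)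
    (him : i ≤ m) (g : 𝒪.OFam Ω n) (A : ℕ → Ω) :
    𝒪.ωcomp hn f i hi1 him g (fun t => A t) =
      𝒪.comp (f fun t => collapse A (i - 1) (n - 1) t) i (g fun s => A (i - 1 + s)) := by
  have hβ : ∀ s, s ≤ m + n - 2 → A (min s (m + n - 2)) = A s := fun s hs => by
    rw [min_eq_left hs]
  simp only [ωcomp]
  congr 2
  · funext t
    have := t.isLt
    simp only [collapse]
    split_ifs
    · exact hβ _ (by omega)
    · exact sprod_congr fun s _ _ => hβ s (by omega)
    · rw [hβ _ (by omega), Nat.add_sub_assoc hn]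
  · funext s
    have := s.isLt
    exact hβ _ (by omega)

end NSOperad

/-- For a semigroup `Ω` and a nonsymmetric operad `𝒪`, the triple
`𝒪^Ω = ({O^Ω(n)}, ∘ᵢ^Ω, 1)` is a nonsymmetric operad: the partial compositions
`∘ᵢ^Ω` satisfy the two associativity axioms and the unit axioms. -/
theorem NSOperad.family_construction_isOperad
    {k : Type u} [CommRing k] [CharZero k] (𝒪 : NSOperad k)
    (Ω : Type w) [Semigroup Ω] :
    (∀ {m n p : ℕ} (f : 𝒪.OFam Ω m) (g : 𝒪.OFam Ω n) (h : 𝒪.OFam Ω p) (i j : ℕ)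
        (hi1 : 1 ≤ i) (him : i ≤ m) (hj1 : 1 ≤ j) (hjn : j ≤ n) (hp : 1 ≤ p),
      𝒪.ωcomp hp (𝒪.ωcomp (hj1.trans hjn) f i hi1 him g) (i + j - 1)
          (by omega) (by omega) h =
        𝒪.ωcast (by omega : m + (n + p - 1) - 1 = m + n - 1 + p - 1)
          (𝒪.ωcomp (by omega : 1 ≤ n + p - 1) f i hi1 him
            (𝒪.ωcomp hp g j hj1 hjn h))) ∧
    (∀ {m n p : ℕ} (f : 𝒪.OFam Ω m) (g : 𝒪.OFam Ω n) (h : 𝒪.OFam Ω p) (i j : ℕ)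
        (hi1 : 1 ≤ i) (hij : i < j) (hjm : j ≤ m) (hn : 1 ≤ n) (hp : 1 ≤ p),
      𝒪.ωcomp hp (𝒪.ωcomp hn f i hi1 (by omega) g) (j + n - 1)
          (by omega) (by omega) h =
        𝒪.ωcast (by omega : m + p - 1 + n - 1 = m + n - 1 + p - 1)
          (𝒪.ωcomp hn (𝒪.ωcomp hp f j (by omega) hjm h) i hi1 (by omega) g)) ∧
    (∀ {m : ℕ} (f : 𝒪.OFam Ω m) (i : ℕ) (hi1 : 1 ≤ i) (him : i ≤ m),
      𝒪.ωcomp (le_refl 1) f i hi1 him (𝒪.ωone Ω) = f) ∧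
    (∀ {m : ℕ} (hm : 1 ≤ m) (f : 𝒪.OFam Ω m),
      𝒪.ωcomp hm (𝒪.ωone Ω) 1 (le_refl 1) (le_refl 1) f =
        𝒪.ωcast (by omega : m = 1 + m - 1) f) := by
  refine ⟨?_, ?_, ?_, ?_⟩
  · intro m n p f g h i j hi1 him hj1 hjn hp
    refine OFam.ext_of_nat 𝒪 (by omega) fun A => ?_
    obtain ⟨a, rfl⟩ := Nat.exists_eq_add_of_le' hi1
    obtain ⟨b, rfl⟩ := Nat.exists_eq_add_of_le' hj1
    have e₁ : a + 1 + (b + 1) - 1 - 1 = a + b := by omega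
    have e₂ : n + p - 1 - 1 = n - 1 + (p - 1) := by omega
    simp only [ωcast_apply, ωcomp_apply, e₁, e₂, add_tsub_cancel_right,
      collapse_collapse_of_mem A (p - 1) (by omega : b ≤ n - 1)]
    rw [𝒪.assoc₁ _ _ _ _ _ hi1 him hj1 hjn hp]
    rw [ωcomp_apply 𝒪 hp g (b + 1) hj1 hjn h fun s => A (a + s)]
    simp only [collapse_shift, add_tsub_cancel_right, add_assoc]
  · intro m n p f g h i j hi1 hij hjm hn hp
    refine OFam.ext_of_nat 𝒪 (by omega) fun A => ?_
    obtain ⟨a, rfl⟩ := Nat.exists_eq_add_of_le' hi1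
    obtain ⟨c, rfl⟩ := Nat.exists_eq_add_of_le' (hi1.trans hij.le)
    have e : c + 1 + n - 1 - 1 = c + (n - 1) := by omega
    simp only [ωcast_apply, ωcomp_apply, e, add_tsub_cancel_right,
      collapse_collapse_comm A (n - 1) (p - 1) (by omega : a < c)]
    rw [𝒪.assoc₂ _ _ _ _ _ hi1 hij hjm hn hp]
    have hg : (fun s : Fin n => collapse A (c + (n - 1)) (p - 1) (a + s)) =
        fun s : Fin n => A (a + s) :=
      funext fun s => collapse_of_lt _ _ (by omega)
    have hh : (fun s : Fin p => collapse A a (n - 1) (c + s)) =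
        fun s : Fin p => A (c + (n - 1) + s) :=
      funext fun s => (collapse_of_gt _ _ (by omega)).trans (congrArg A (by omega))
    rw [hg, hh]
  · intro m f i hi1 him
    refine OFam.ext_of_nat 𝒪 (by omega) fun A => ?_
    rw [ωcomp_apply, tsub_self, collapse_zero]
    exact 𝒪.comp_one _ i hi1 him
  · intro m hm f
    refine OFam.ext_of_nat 𝒪 (by omega) fun A => ?_
    rw [ωcomp_apply, ωcast_apply]
    simp only [tsub_self, zero_add]
    exact 𝒪.one_comp _
end
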